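/- arXiv:1008.2716 — 3 statements merged into one kernel-verified Lean document; each statement's English description precedes it below -/
import Mathlib

section
/- Let C be a nonzero Weyl candidate on n-dimensional Minkowski vector space with superenergy tensor 𝒯, and let ℓ be a causal vector. Then 𝒯_{αβλμ}ℓ^αℓ^λ = 0 for all β,μ if and only if both of the following hold: (a) the antisymmetrization of ℓ_β C_{αρσλ} ℓ_μ over the index triple (β,α,ρ) and over the index triple (σ,λ,μ) vanishes identically, and (b) the antisymmetrization of E_{ασλ} ℓ_μ over the index triple (σ,λ,μ) vanishes identically, where E_{ασλ} := C_{αρσλ}ℓ^ρ. Moreover, if either side holds then ℓ is necessarily null. -/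
open Finset

noncomputable section

/-- Sign of the `i`-th diagonal entry of the Minkowski metric diag(-1,1,...,1). -/
def sgn {n : ℕ} (i : Fin n) : ℝ := if (i : ℕ) = 0 then -1 else 1

/-- The Minkowski metric components η_{ij} (= η^{ij}). -/
def eta {n : ℕ} (i j : Fin n) : ℝ := if i = j then sgn i else 0

/-- Minkowski square η(v,v) of a vector. -/
def mSq {n : ℕ} (v : Fin n → ℝ) : ℝ := ∑ i, sgn i * v i * v i

/-- Lowered components v_i = η_{ij} v^j. -/
def lo {n : ℕ} (v : Fin n → ℝ) (i : Fin n) : ℝ := sgn i * v i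

/-- A Weyl candidate: the index symmetries of the Weyl tensor plus tracelessness. -/
def IsWeyl {n : ℕ} (C : Fin n → Fin n → Fin n → Fin n → ℝ) : Prop :=
  (∀ a b l m, C b a l m = - C a b l m) ∧
  (∀ a b l m, C a b m l = - C a b l m) ∧
  (∀ a b l m, C a b l m = C l m a b) ∧
  (∀ a b l m, C a b l m + C a l m b + C a m b l = 0) ∧
  (∀ b m, ∑ a, sgn a * C a b a m = 0)

/-- The superenergy (generalized Bel–Robinson) tensor of a Weyl candidate. -/
def SE {n : ℕ} (C : Fin n → Fin n → Fin n → Fin n → ℝ) (a b l m : Fin n) : ℝ :=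
  (∑ r, ∑ s, sgn r * sgn s * (C a r l s * C b r m s + C a r m s * C b r l s))
  - (1/2) * eta a b * (∑ r, ∑ t, ∑ s, sgn r * sgn t * sgn s * C r t l s * C r t m s)
  - (1/2) * eta l m * (∑ r, ∑ s, ∑ t, sgn r * sgn s * sgn t * C a r s t * C b r s t)
  + (1/8) * eta a b * eta l m *
      (∑ r, ∑ t, ∑ s, ∑ v, sgn r * sgn t * sgn s * sgn v * C r t s v * C r t s v)

/-- Contraction of the first index of a 2-index array with `ℓ`. -/
def contr {n : ℕ} (ℓ : Fin n → ℝ) (F : Fin n → Fin n → ℝ) (r : Fin n) : ℝ :=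
  ∑ a, ℓ a * F a r

/-- Wedge product of the covector `lo ℓ` with a 2-form. -/
def wedge {n : ℕ} (ℓ : Fin n → ℝ) (F : Fin n → Fin n → ℝ) (a b c : Fin n) : ℝ :=
  lo ℓ a * F b c + lo ℓ b * F c a + lo ℓ c * F a b

/-- The symmetrized energy-momentum form of a pair of 2-forms, with one index contracted with `ℓ`
and the other equal to `b`, as a linear functional of the tensor product of the pair. -/
def energy {n : ℕ} (ℓ : Fin n → ℝ) (b : Fin n) :
    (Fin n → Fin n → Fin n → Fin n → ℝ) →ₗ[ℝ] ℝ where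
  toFun N := (1/2) * (∑ r, ∑ a, sgn r * ℓ a * (N a r b r + N b r a r))
    - (1/4) * lo ℓ b * (∑ r, ∑ t, sgn r * sgn t * N r t r t)
  map_add' N N' := by
    simp only [Pi.add_apply, mul_add, sum_add_distrib]
    ring
  map_smul' c N := by
    simp only [Pi.smul_apply, smul_eq_mul, RingHom.id_apply, mul_sub, mul_sum]
    congr 1 <;> refine sum_congr rfl fun _ _ => sum_congr rfl fun _ _ => ?_ <;> ring

/-- The tensor product of two 2-index arrays. -/
def tmul {n : ℕ} (F G : Fin n → Fin n → ℝ) (s t s' t' : Fin n) : ℝ := F s t * G s' t'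

theorem sgn_mul_self {n : ℕ} (i : Fin n) : sgn i * sgn i = 1 := by
  unfold sgn; split_ifs <;> norm_num

theorem sgn_mul_lo {n : ℕ} (ℓ : Fin n → ℝ) (i : Fin n) : sgn i * lo ℓ i = ℓ i := by
  rw [lo, ← mul_assoc, sgn_mul_self, one_mul]

theorem energy_apply {n : ℕ} (ℓ : Fin n → ℝ) (b : Fin n)
    (N : Fin n → Fin n → Fin n → Fin n → ℝ) :
    energy ℓ b N = (1/2) * (∑ r, ∑ a, sgn r * ℓ a * (N a r b r + N b r a r))
      - (1/4) * lo ℓ b * (∑ r, ∑ t, sgn r * sgn t * N r t r t) := rfl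

theorem energy_tmul {n : ℕ} (ℓ : Fin n → ℝ) (b : Fin n) (F G : Fin n → Fin n → ℝ) :
    energy ℓ b (tmul F G) =
      (1/2) * (∑ r, sgn r * (contr ℓ F r * G b r + contr ℓ G r * F b r))
      - (1/4) * lo ℓ b * (∑ r, ∑ t, sgn r * sgn t * (F r t * G r t)) := by
  rw [energy_apply]
  congr 2
  refine sum_congr rfl fun r _ => ?_
  simp only [contr, tmul, sum_mul, mul_sum, ← sum_add_distrib]
  exact sum_congr rfl fun a _ => by ring

theorem energy_tmul_eq_contr_wedge {n : ℕ} (ℓ : Fin n → ℝ) (b : Fin n)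
    (F G : Fin n → Fin n → ℝ) (hF : ∀ a c, F c a = - F a c) (hG : ∀ a c, G c a = - G a c) :
    energy ℓ b (tmul F G) = (∑ r, (1/2) * sgn r * (contr ℓ F r * G b r))
      - ∑ r, ∑ t, (1/4) * (sgn r * sgn t) * (wedge ℓ F b r t * G r t) := by
  have h1 : ∑ r, ∑ t, sgn r * sgn t * (lo ℓ r * F t b) * G r t
      = - ∑ r, sgn r * (contr ℓ G r * F b r) := by
    rw [sum_comm, ← sum_neg_distrib]
    refine sum_congr rfl fun t _ => ?_
    simp only [contr, sum_mul, mul_sum, ← sum_neg_distrib]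
    refine sum_congr rfl fun r _ => ?_
    rw [hF b t, ← sgn_mul_lo ℓ r]; ring
  have h2 : ∑ r, ∑ t, sgn r * sgn t * (lo ℓ t * F b r) * G r t
      = - ∑ r, sgn r * (contr ℓ G r * F b r) := by
    rw [← sum_neg_distrib]
    refine sum_congr rfl fun t _ => ?_
    simp only [contr, sum_mul, mul_sum, ← sum_neg_distrib]
    refine sum_congr rfl fun r _ => ?_
    rw [hG r t, ← sgn_mul_lo ℓ r]; ring
  have h3 : ∑ r, ∑ t, (1/4) * (sgn r * sgn t) * (wedge ℓ F b r t * G r t)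
      = (1/4) * lo ℓ b * (∑ r, ∑ t, sgn r * sgn t * (F r t * G r t))
        + (1/4) * (∑ r, ∑ t, sgn r * sgn t * (lo ℓ r * F t b) * G r t)
        + (1/4) * (∑ r, ∑ t, sgn r * sgn t * (lo ℓ t * F b r) * G r t) := by
    simp only [mul_sum, ← sum_add_distrib]
    refine sum_congr rfl fun r _ => sum_congr rfl fun t _ => ?_
    rw [wedge]; ring
  have h4 : ∑ r, (1/2) * sgn r * (contr ℓ F r * G b r)
      = (1/2) * ∑ r, sgn r * (contr ℓ F r * G b r) := by
    rw [mul_sum]; exact sum_congr rfl fun r _ => by ring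
  rw [energy_tmul, h3, h1, h2, h4]
  simp only [mul_add, sum_add_distrib]
  ring

theorem sgn_eq {n : ℕ} {z : Fin n} (hz : (z : ℕ) = 0) (r : Fin n) :
    sgn r = 1 - 2 * (if r = z then 1 else 0) := by
  unfold sgn
  simp only [Fin.ext_iff, hz]
  split_ifs <;> norm_num

theorem sum_rotate_three {n : ℕ} (f : Fin n → Fin n → Fin n → ℝ) :
    ∑ a, ∑ b, ∑ c, f b c a = ∑ a, ∑ b, ∑ c, f a b c := by
  rw [sum_comm]
  exact sum_congr rfl fun b _ => sum_comm

theorem sum_rotate_four {n : ℕ} (f : Fin n → Fin n → Fin n → Fin n → ℝ) :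
    ∑ a, ∑ b, ∑ c, ∑ d, f a b c d = ∑ d, ∑ a, ∑ b, ∑ c, f a b c d := by
  rw [sum_comm (s := univ) (t := univ) (f := fun d a => ∑ b, ∑ c, f a b c d)]
  exact sum_congr rfl fun a _ => (sum_rotate_three (f a)).symm

theorem sum_wedge_mul_wedge {n : ℕ} (ℓ : Fin n → ℝ) (F G : Fin n → Fin n → ℝ)
    (hF : ∀ a c, F c a = - F a c) (hG : ∀ a c, G c a = - G a c) :
    ∑ a, ∑ b, ∑ c, wedge ℓ F a b c * wedge ℓ G a b c
      = 3 * ((∑ a, ℓ a * ℓ a) * (∑ a, ∑ b, F a b * G a b))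
        - 6 * ∑ r, contr (lo ℓ) F r * contr (lo ℓ) G r := by
  have cyc := sum_rotate_three (n := n)
  have hA : ∑ a, ∑ b, ∑ c, (lo ℓ a * F b c) * (lo ℓ a * G b c)
      = (∑ a, ℓ a * ℓ a) * (∑ a, ∑ b, F a b * G a b) := by
    rw [sum_mul]
    simp only [mul_sum]
    refine sum_congr rfl fun a _ => sum_congr rfl fun b _ => sum_congr rfl fun c _ => ?_
    rw [← sgn_mul_lo ℓ a]
    linear_combination (-(lo ℓ a * F b c) * (lo ℓ a * G b c)) * sgn_mul_self a
  have hB : ∑ a, ∑ b, ∑ c, (lo ℓ a * F b c) * (lo ℓ b * G c a)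
      = - ∑ r, contr (lo ℓ) F r * contr (lo ℓ) G r := by
    rw [← cyc, ← sum_neg_distrib]
    refine sum_congr rfl fun a _ => ?_
    simp only [contr, sum_mul, mul_sum, ← sum_neg_distrib]
    refine sum_congr rfl fun b _ => sum_congr rfl fun c _ => ?_
    rw [hG b a]; ring
  have hB' : ∑ a, ∑ b, ∑ c, (lo ℓ a * G b c) * (lo ℓ b * F c a)
      = - ∑ r, contr (lo ℓ) F r * contr (lo ℓ) G r := by
    rw [← cyc, ← sum_neg_distrib]
    refine sum_congr rfl fun a _ => ?_
    simp only [contr, sum_mul, mul_sum, ← sum_neg_distrib]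
    rw [sum_comm]
    refine sum_congr rfl fun b _ => sum_congr rfl fun c _ => ?_
    rw [hF c a]; ring
  let f : Fin n → Fin n → Fin n → ℝ := fun a b c =>
    (lo ℓ a * F b c) * (lo ℓ a * G b c) + (lo ℓ a * F b c) * (lo ℓ b * G c a)
      + (lo ℓ a * G b c) * (lo ℓ b * F c a)
  have hf : ∑ a, ∑ b, ∑ c, wedge ℓ F a b c * wedge ℓ G a b c
      = (∑ a, ∑ b, ∑ c, f a b c) + (∑ a, ∑ b, ∑ c, f b c a)
        + ∑ a, ∑ b, ∑ c, f c a b := by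
    simp only [← sum_add_distrib]
    refine sum_congr rfl fun a _ => sum_congr rfl fun b _ => sum_congr rfl fun c _ => ?_
    simp only [wedge, f]; ring
  have h2 : ∑ a, ∑ b, ∑ c, f c a b = ∑ a, ∑ b, ∑ c, f a b c :=
    (cyc fun a b c => f c a b).symm
  rw [hf, h2, cyc f]
  simp only [f, sum_add_distrib]
  rw [hA, hB, hB']
  ring

theorem energy_tmul_time {n : ℕ} (ℓ : Fin n → ℝ) {z : Fin n} (hz : (z : ℕ) = 0)
    (F G : Fin n → Fin n → ℝ) (hF : ∀ a c, F c a = - F a c) (hG : ∀ a c, G c a = - G a c) :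
    4 * ℓ z * energy ℓ z (tmul F G) = (∑ r, contr ℓ F r * contr ℓ G r)
      + (∑ a, ∑ b, ∑ c, (1/6) * (wedge ℓ F a b c * wedge ℓ G a b c))
      + ∑ a, ∑ b, (- mSq ℓ / 2) * (F a b * G a b) := by
  have hlo : ∀ H : Fin n → Fin n → ℝ, ∀ r, contr (lo ℓ) H r = contr ℓ H r - 2 * (ℓ z * H z r) := by
    intro H r
    have : ∀ a, lo ℓ a * H a r = ℓ a * H a r - 2 * (if a = z then ℓ a * H a r else 0) := by
      intro a
      rw [lo, sgn_eq hz]; split_ifs <;> ring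
    simp only [contr, this, sum_sub_distrib, ← mul_sum, sum_ite_eq', mem_univ, if_true]
  have hsq : mSq ℓ = (∑ a, ℓ a * ℓ a) - 2 * (ℓ z * ℓ z) := by
    have : ∀ a, sgn a * ℓ a * ℓ a = ℓ a * ℓ a - 2 * (if a = z then ℓ a * ℓ a else 0) := by
      intro a
      rw [sgn_eq hz]; split_ifs <;> ring
    simp only [mSq, this, sum_sub_distrib, ← mul_sum, sum_ite_eq', mem_univ, if_true]
  have hzz : ∀ H : Fin n → Fin n → ℝ, (∀ a c, H c a = - H a c) → H z z = 0 := by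
    intro H h
    linarith [h z z]
  have hsg : ∀ H K : Fin n → Fin n → ℝ, (∀ a c, H c a = - H a c) →
      ∑ r, sgn r * (contr ℓ K r * H z r) = ∑ r, contr ℓ K r * H z r := by
    intro H K h
    refine sum_congr rfl fun r _ => ?_
    by_cases hr : r = z
    · rw [hr, hzz H h]; ring
    · rw [sgn_eq hz, if_neg hr]; ring
  have hFG : ∑ r, ∑ t, sgn r * sgn t * (F r t * G r t)
      = (∑ r, ∑ t, F r t * G r t) - 4 * ∑ r, F z r * G z r := by
    have : ∀ r t, sgn r * sgn t * (F r t * G r t) = F r t * G r t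
        - 2 * (if r = z then F z t * G z t else 0) - 2 * (if t = z then F z r * G z r else 0) := by
      intro r t
      rw [sgn_eq hz r, sgn_eq hz t]
      split_ifs with h1 h2 h2
      · rw [h1, h2, hzz F hF]; ring
      · rw [h1]; ring
      · rw [h2, hF z r, hG z r]; ring
      · ring
    simp only [this, sum_sub_distrib, ← mul_sum, sum_ite_eq', mem_univ, if_true]
    rw [sum_comm (f := fun x i => if x = z then F z i * G z i else 0)]
    simp only [sum_ite_eq', mem_univ, if_true]
    ring
  have hloz : lo ℓ z = - ℓ z := by rw [lo, sgn_eq hz, if_pos rfl]; ring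
  have hcc : ∑ r, contr (lo ℓ) F r * contr (lo ℓ) G r
      = (∑ r, contr ℓ F r * contr ℓ G r) - 2 * ℓ z * (∑ r, contr ℓ F r * G z r)
        - 2 * ℓ z * (∑ r, contr ℓ G r * F z r) + 4 * (ℓ z * ℓ z) * (∑ r, F z r * G z r) := by
    simp only [mul_sum, ← sum_add_distrib, ← sum_sub_distrib, hlo]
    exact sum_congr rfl fun r _ => by ring
  simp only [← mul_sum]
  rw [energy_tmul, sum_wedge_mul_wedge ℓ F G hF hG, hcc, hFG, hloz, hsq]
  simp only [mul_add, sum_add_distrib]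
  rw [hsg G F hG, hsg F G hF]
  ring

theorem sum_eta_mul {n : ℕ} (ℓ : Fin n → ℝ) (b : Fin n) : ∑ a, eta a b * ℓ a = lo ℓ b := by
  simp [eta, lo]

theorem sum_SE_eq_energy {n : ℕ} (C : Fin n → Fin n → Fin n → Fin n → ℝ) (ℓ : Fin n → ℝ)
    (b m : Fin n) :
    ∑ a, ∑ l, SE C a b l m * ℓ a * ℓ l = 2 * energy ℓ m (fun s t s' t' =>
      energy ℓ b (tmul (fun a c => C a c s t) (fun a c => C a c s' t'))) := by
  let W : Fin n → Fin n → Fin n → Fin n → ℝ := fun a l r s =>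
    sgn r * sgn s * (C a r l s * C b r m s + C a r m s * C b r l s) * (ℓ a * ℓ l)
  let X : Fin n → Fin n → Fin n → Fin n → ℝ := fun l r t s =>
    sgn r * sgn t * sgn s * C r t l s * C r t m s * ℓ l
  let Y : Fin n → Fin n → Fin n → Fin n → ℝ := fun a r s t =>
    sgn r * sgn s * sgn t * C a r s t * C b r s t * ℓ a
  let Z : Fin n → Fin n → Fin n → Fin n → ℝ := fun r t s v =>
    sgn r * sgn t * sgn s * sgn v * C r t s v * C r t s v
  obtain ⟨z, hz⟩ : ∃ z, z = ∑ r, ∑ t, ∑ s, ∑ v, Z r t s v := ⟨_, rfl⟩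
  have hL : ∑ a, ∑ l, SE C a b l m * ℓ a * ℓ l = (∑ a, ∑ l, ∑ r, ∑ s, W a l r s)
      - (1/2) * (lo ℓ b * ∑ l, ∑ r, ∑ t, ∑ s, X l r t s)
      - (1/2) * ((∑ a, ∑ r, ∑ s, ∑ t, Y a r s t) * lo ℓ m)
      + (1/8 * z) * (lo ℓ b * lo ℓ m) := by
    rw [← sum_eta_mul ℓ b, ← sum_eta_mul ℓ m, sum_mul_sum, sum_mul_sum, sum_mul_sum]
    rw [mul_sum, mul_sum, mul_sum, ← sum_sub_distrib, ← sum_sub_distrib,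
      ← sum_add_distrib]
    refine sum_congr rfl fun a _ => ?_
    rw [mul_sum, mul_sum, mul_sum, ← sum_sub_distrib, ← sum_sub_distrib,
      ← sum_add_distrib]
    refine sum_congr rfl fun l _ => ?_
    simp only [hz, SE, W, X, Y, Z, ← sum_mul]
    ring
  have hN : ∀ s t s' t', energy ℓ b (tmul (fun a c => C a c s t) (fun a c => C a c s' t'))
      = (1/2) * (∑ r, ∑ a, sgn r * ℓ a * (C a r s t * C b r s' t' + C b r s t * C a r s' t'))
      - (1/4) * lo ℓ b * (∑ r, ∑ a, sgn r * sgn a * (C r a s t * C r a s' t')) :=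
    fun _ _ _ _ => rfl
  have hW : ∑ a, ∑ l, ∑ r, ∑ s, W a l r s = ∑ s, ∑ l, ∑ r, ∑ a, W a l r s := by
    rw [sum_rotate_four]
    exact sum_congr rfl fun s _ => sum_rotate_three fun l r a => W a l r s
  have hX : ∑ l, ∑ r, ∑ t, ∑ s, X l r t s = ∑ s, ∑ l, ∑ r, ∑ t, X l r t s := by
    rw [sum_rotate_four]
  have hY : ∑ a, ∑ r, ∑ s, ∑ t, Y a r s t = ∑ s, ∑ t, ∑ r, ∑ a, Y a r s t := by
    rw [sum_rotate_four, sum_rotate_four]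
    exact sum_congr rfl fun s _ => sum_congr rfl fun t _ => sum_comm
  have hZ : ∑ r, ∑ t, ∑ s, ∑ v, Z r t s v = ∑ s, ∑ v, ∑ r, ∑ t, Z r t s v := by
    rw [sum_rotate_four, sum_rotate_four]
  have hR : ∑ s, ∑ l, sgn s * ℓ l *
        (energy ℓ b (tmul (fun a c => C a c l s) (fun a c => C a c m s))
          + energy ℓ b (tmul (fun a c => C a c m s) (fun a c => C a c l s)))
      = (∑ s, ∑ l, ∑ r, ∑ a, W a l r s)
        - (1/2) * (lo ℓ b * ∑ s, ∑ l, ∑ r, ∑ t, X l r t s) := by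
    simp only [hN, mul_sum, ← sum_add_distrib, ← sum_sub_distrib, W, X]
    refine sum_congr rfl fun s _ => sum_congr rfl fun l _ => ?_
    refine sum_congr rfl fun r _ => sum_congr rfl fun a _ => ?_
    ring
  have hR' : ∑ s, ∑ t, sgn s * sgn t *
        energy ℓ b (tmul (fun a c => C a c s t) (fun a c => C a c s t))
      = (∑ s, ∑ t, ∑ r, ∑ a, Y a r s t)
        - (1/4) * (lo ℓ b * ∑ s, ∑ v, ∑ r, ∑ t, Z r t s v) := by
    simp only [hN, mul_sum, ← sum_sub_distrib, Y, Z]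
    refine sum_congr rfl fun s _ => sum_congr rfl fun l _ => ?_
    refine sum_congr rfl fun r _ => sum_congr rfl fun a _ => ?_
    ring
  rw [hL, hz, hW, hX, hY, hZ, energy_apply, hR, hR']
  ring

theorem sum_perm_three {n : ℕ} (f : Fin n → Fin n → Fin n → ℝ) (p : Fin 3 → Fin n) :
    ∑ σ : Equiv.Perm (Fin 3), ((Equiv.Perm.sign σ : ℤ) : ℝ) * f (p (σ 0)) (p (σ 1)) (p (σ 2))
      = f (p 0) (p 1) (p 2) + f (p 1) (p 2) (p 0) + f (p 2) (p 0) (p 1)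
        - f (p 0) (p 2) (p 1) - f (p 1) (p 0) (p 2) - f (p 2) (p 1) (p 0) := by
  have h : (univ : Finset (Equiv.Perm (Fin 3))) = {1, Equiv.swap 0 1, Equiv.swap 0 2,
      Equiv.swap 1 2, Equiv.swap 0 1 * Equiv.swap 1 2, Equiv.swap 1 2 * Equiv.swap 0 1} := by
    decide
  rw [h, sum_insert (by decide), sum_insert (by decide), sum_insert (by decide),
    sum_insert (by decide), sum_insert (by decide), sum_singleton]
  have e1 : (Equiv.swap 0 1 : Equiv.Perm (Fin 3)) 2 = 2 := by decide
  have e2 : (Equiv.swap 0 2 : Equiv.Perm (Fin 3)) 1 = 1 := by decide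
  have e3 : (Equiv.swap 1 2 : Equiv.Perm (Fin 3)) 0 = 0 := by decide
  simp [e1, e2, e3]
  ring

theorem sum_perm_lo_mul {n : ℕ} (ℓ : Fin n → ℝ) (F : Fin n → Fin n → ℝ)
    (hF : ∀ a c, F c a = - F a c) (p : Fin 3 → Fin n) :
    ∑ σ : Equiv.Perm (Fin 3), ((Equiv.Perm.sign σ : ℤ) : ℝ) *
      (lo ℓ (p (σ 0)) * F (p (σ 1)) (p (σ 2))) = 2 * wedge ℓ F (p 0) (p 1) (p 2) := by
  rw [sum_perm_three (fun a b c => lo ℓ a * F b c), wedge, hF (p 1) (p 2), hF (p 2) (p 0),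
    hF (p 0) (p 1)]
  ring

theorem sum_perm_mul_lo {n : ℕ} (ℓ : Fin n → ℝ) (F : Fin n → Fin n → ℝ)
    (hF : ∀ a c, F c a = - F a c) (p : Fin 3 → Fin n) :
    ∑ σ : Equiv.Perm (Fin 3), ((Equiv.Perm.sign σ : ℤ) : ℝ) *
      (F (p (σ 0)) (p (σ 1)) * lo ℓ (p (σ 2))) = 2 * wedge ℓ F (p 0) (p 1) (p 2) := by
  rw [sum_perm_three (fun a b c => F a b * lo ℓ c), wedge, hF (p 1) (p 2), hF (p 2) (p 0),
    hF (p 0) (p 1)]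
  ring

/-- Contraction of the first index of a 4-index array with `ℓ`. -/
def contrFst {n : ℕ} (ℓ : Fin n → ℝ) (C : Fin n → Fin n → Fin n → Fin n → ℝ)
    (r s t : Fin n) : ℝ := contr ℓ (fun a c => C a c s t) r

/-- Wedge product of `lo ℓ` with the first index pair of a 4-index array. -/
def wedgeFst {n : ℕ} (ℓ : Fin n → ℝ) (C : Fin n → Fin n → Fin n → Fin n → ℝ)
    (a b c s t : Fin n) : ℝ := wedge ℓ (fun x y => C x y s t) a b c

theorem contrFst_swap {n : ℕ} (ℓ : Fin n → ℝ) {C : Fin n → Fin n → Fin n → Fin n → ℝ}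
    (h : ∀ a b l m, C a b m l = - C a b l m) (r s t : Fin n) :
    contrFst ℓ C r t s = - contrFst ℓ C r s t := by
  simp only [contrFst, contr, ← sum_neg_distrib]
  exact sum_congr rfl fun a _ => by rw [h a r s t]; ring

theorem wedgeFst_swap {n : ℕ} (ℓ : Fin n → ℝ) {C : Fin n → Fin n → Fin n → Fin n → ℝ}
    (h : ∀ a b l m, C a b m l = - C a b l m) (a b c s t : Fin n) :
    wedgeFst ℓ C a b c t s = - wedgeFst ℓ C a b c s t := by
  simp only [wedgeFst, wedge, h _ _ s t]
  ring

theorem contr_wedgeFst {n : ℕ} (ℓ : Fin n → ℝ) {C : Fin n → Fin n → Fin n → Fin n → ℝ}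
    (h : ∀ a b l m, C a b l m = C l m a b) (a b c s : Fin n) :
    contr ℓ (wedgeFst ℓ C a b c) s = wedge ℓ (contrFst ℓ C s) a b c := by
  simp only [contr, wedgeFst, wedge, contrFst, mul_sum, ← sum_add_distrib]
  refine sum_congr rfl fun d _ => ?_
  rw [h d s b c, h d s c a, h d s a b]
  ring

theorem energy_tmul_eq_zero {n : ℕ} (ℓ : Fin n → ℝ) (b : Fin n) {F G : Fin n → Fin n → ℝ}
    (hF : ∀ a c, F c a = - F a c) (hG : ∀ a c, G c a = - G a c)
    (h1 : ∀ r, contr ℓ F r = 0) (h2 : ∀ a c d, wedge ℓ F a c d = 0) :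
    energy ℓ b (tmul F G) = 0 := by
  simp [energy_tmul_eq_contr_wedge ℓ b F G hF hG, h1, h2]

theorem energy_energy_eq {n : ℕ} (ℓ : Fin n → ℝ) (b m : Fin n)
    {C : Fin n → Fin n → Fin n → Fin n → ℝ} (h : ∀ a b l m, C b a l m = - C a b l m) :
    energy ℓ m (fun s t s' t' =>
        energy ℓ b (tmul (fun a c => C a c s t) (fun a c => C a c s' t')))
      = (∑ r, (1/2) * sgn r * energy ℓ m (tmul (contrFst ℓ C r) (C b r)))
      - ∑ r, ∑ t, (1/4) * (sgn r * sgn t) * energy ℓ m (tmul (wedgeFst ℓ C b r t) (C r t)) := by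
  have hN : (fun s t s' t' =>
        energy ℓ b (tmul (fun a c => C a c s t) (fun a c => C a c s' t')))
      = (∑ r, ((1/2) * sgn r) • tmul (contrFst ℓ C r) (C b r))
      - ∑ r, ∑ t, ((1/4) * (sgn r * sgn t)) • tmul (wedgeFst ℓ C b r t) (C r t) := by
    funext s t s' t'
    rw [energy_tmul_eq_contr_wedge ℓ b _ _ (fun _ _ => h _ _ _ _) (fun _ _ => h _ _ _ _)]
    simp only [Pi.sub_apply, Finset.sum_apply, Pi.smul_apply, smul_eq_mul, tmul, contrFst,
      wedgeFst]
  simp only [hN, map_sub, map_sum, map_smul, smul_eq_mul]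

theorem energy_energy_time {n : ℕ} (ℓ : Fin n → ℝ) {z : Fin n} (hz : (z : ℕ) = 0)
    {C : Fin n → Fin n → Fin n → Fin n → ℝ} (h : ∀ a b l m, C b a l m = - C a b l m) :
    4 * ℓ z * energy ℓ z (fun s t s' t' =>
        energy ℓ z (tmul (fun a c => C a c s t) (fun a c => C a c s' t')))
      = (∑ r, energy ℓ z (tmul (contrFst ℓ C r) (contrFst ℓ C r)))
      + (∑ a, ∑ b, ∑ c,
          (1/6) * energy ℓ z (tmul (wedgeFst ℓ C a b c) (wedgeFst ℓ C a b c)))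
      + ∑ a, ∑ b, (- mSq ℓ / 2) * energy ℓ z (tmul (C a b) (C a b)) := by
  have hN : (4 * ℓ z) • (fun s t s' t' =>
        energy ℓ z (tmul (fun a c => C a c s t) (fun a c => C a c s' t')))
      = (∑ r, tmul (contrFst ℓ C r) (contrFst ℓ C r))
      + (∑ a, ∑ b, ∑ c, (1/6 : ℝ) • tmul (wedgeFst ℓ C a b c) (wedgeFst ℓ C a b c))
      + ∑ a, ∑ b, (- mSq ℓ / 2) • tmul (C a b) (C a b) := by
    funext s t s' t'
    simp only [Pi.add_apply, Finset.sum_apply, Pi.smul_apply, smul_eq_mul]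
    rw [energy_tmul_time ℓ hz _ _ (fun _ _ => h _ _ _ _) (fun _ _ => h _ _ _ _)]
    simp only [tmul, contrFst, wedgeFst]
  rw [← smul_eq_mul, ← map_smul, hN]
  simp only [map_add, map_sum, map_smul, smul_eq_mul]

theorem energy_time_self {n : ℕ} {ℓ : Fin n → ℝ} {z : Fin n} (hz : (z : ℕ) = 0)
    {F : Fin n → Fin n → ℝ} (hF : ∀ a c, F c a = - F a c) (hℓ : mSq ℓ ≤ 0) :
    0 ≤ 4 * ℓ z * energy ℓ z (tmul F F) ∧ (4 * ℓ z * energy ℓ z (tmul F F) = 0 →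
      (∀ r, contr ℓ F r = 0) ∧ (∀ a b c, wedge ℓ F a b c = 0) ∧
      ∀ a b, mSq ℓ * F a b = 0) := by
  rw [energy_tmul_time ℓ hz F F hF hF]
  have h1 : ∀ r ∈ univ, 0 ≤ contr ℓ F r * contr ℓ F r := fun r _ => mul_self_nonneg _
  have h2 : ∀ x ∈ (univ : Finset (Fin n × Fin n × Fin n)),
      0 ≤ (1/6) * (wedge ℓ F x.1 x.2.1 x.2.2 * wedge ℓ F x.1 x.2.1 x.2.2) :=
    fun x _ => mul_nonneg (by norm_num) (mul_self_nonneg _)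
  have h3 : ∀ x ∈ (univ : Finset (Fin n × Fin n)),
      0 ≤ (- mSq ℓ / 2) * (F x.1 x.2 * F x.1 x.2) :=
    fun x _ => mul_nonneg (by linarith) (mul_self_nonneg _)
  have e2 := sum_nonneg h2
  have e3 := sum_nonneg h3
  have e1 := sum_nonneg h1
  have z2 := sum_eq_zero_iff_of_nonneg h2
  have z3 := sum_eq_zero_iff_of_nonneg h3
  simp only [Fintype.sum_prod_type] at e2 e3 z2 z3
  refine ⟨by linarith, fun h => ⟨fun r => ?_, fun a b c => ?_, fun a b => ?_⟩⟩
  · exact mul_self_eq_zero.1 ((sum_eq_zero_iff_of_nonneg h1).1 (by linarith) r (mem_univ _))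
  · have := z2.1 (by linarith) (a, b, c) (mem_univ _)
    exact mul_self_eq_zero.1 (by linarith)
  · have := z3.1 (by linarith) (a, b) (mem_univ _)
    rcases mul_eq_zero.1 this with h | h
    · rw [show mSq ℓ = 0 by linarith, zero_mul]
    · rw [mul_self_eq_zero.1 h, mul_zero]

theorem contr_contrFst_eq_zero {n : ℕ} (ℓ : Fin n → ℝ)
    {C : Fin n → Fin n → Fin n → Fin n → ℝ} (hC : IsWeyl C)
    (h : ∀ a b c d e f, wedge ℓ (wedgeFst ℓ C a b c) d e f = 0) (b e : Fin n) :
    contr ℓ (contrFst ℓ C b) e = 0 := by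
  obtain ⟨h12, h34, hp, -, htr⟩ := hC
  have hD : ∀ a c, sgn a * sgn c * wedge ℓ (wedgeFst ℓ C a b c) a e c
      = (sgn a * lo ℓ a * lo ℓ a) * (sgn c * C c b c e)
      - (sgn a * lo ℓ a * lo ℓ b) * (sgn c * C c a c e)
      - (sgn a * lo ℓ a * lo ℓ e) * (sgn c * C c b c a)
      + (sgn a * lo ℓ e * lo ℓ b) * (sgn c * C c a c a)
      - (sgn c * lo ℓ c * lo ℓ e) * (sgn a * C a b a c)
      - (sgn c * lo ℓ c * lo ℓ b) * (sgn a * C a c a e)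
      + (sgn c * lo ℓ c * lo ℓ c) * (sgn a * C a b a e)
      - ℓ c * (ℓ a * C a b c e) - ℓ a * (ℓ c * C c b a e) := by
    intro a c
    simp only [wedge, wedgeFst]
    rw [← sgn_mul_lo ℓ a, ← sgn_mul_lo ℓ c]
    rw [h12 c b e c, h34 c b c e, h34 c a c e, h34 a b c e, h12 c b c a, h34 a b a c,
      h12 c b a e, h12 a c a e]
    ring
  have hA : ∑ a, ∑ c, (sgn a * sgn c * wedge ℓ (wedgeFst ℓ C a b c) a e c)
      = - 2 * contr ℓ (contrFst ℓ C b) e := by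
    simp only [hD, sum_sub_distrib, sum_add_distrib, ← mul_sum, htr]
    rw [sum_comm (f := fun a c => (sgn c * lo ℓ c * lo ℓ e) * (sgn a * C a b a c)),
      sum_comm (f := fun a c => (sgn c * lo ℓ c * lo ℓ b) * (sgn a * C a c a e)),
      sum_comm (f := fun a c => (sgn c * lo ℓ c * lo ℓ c) * (sgn a * C a b a e)),
      sum_comm (f := fun a c => ℓ c * (ℓ a * C a b c e))]
    simp only [← mul_sum, htr, contr, contrFst]
    simp only [mul_zero, sum_const_zero]
    ring
  simp only [h, mul_zero, sum_const_zero] at hA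
  linarith

/-- 𝒯_{αβλμ}ℓ^αℓ^λ = 0 iff (a) the antisymmetrization of
ℓ_β C_{αρσλ} ℓ_μ over the triples (β,α,ρ) and (σ,λ,μ) vanishes and
(b) the antisymmetrization of E_{ασλ} ℓ_μ over the triple (σ,λ,μ) vanishes,
where E_{ασλ} := C_{αρσλ}ℓ^ρ; moreover ℓ is then null. -/
theorem stmt_3 {n : ℕ} (hn : 2 ≤ n) (C : Fin n → Fin n → Fin n → Fin n → ℝ)
    (hC : IsWeyl C) (hC0 : C ≠ 0)
    (ℓ : Fin n → ℝ) (hℓ0 : ℓ ≠ 0) (hcausal : mSq ℓ ≤ 0) :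
    ((∀ b m : Fin n, ∑ a, ∑ l, SE C a b l m * ℓ a * ℓ l = 0) ↔
      ((∀ p q : Fin 3 → Fin n,
        ∑ σ : Equiv.Perm (Fin 3), ∑ τ : Equiv.Perm (Fin 3),
          ((Equiv.Perm.sign σ : ℤ) : ℝ) * ((Equiv.Perm.sign τ : ℤ) : ℝ) *
            (lo ℓ (p (σ 0)) * C (p (σ 1)) (p (σ 2)) (q (τ 0)) (q (τ 1)) * lo ℓ (q (τ 2))) = 0)
       ∧
       (∀ a : Fin n, ∀ q : Fin 3 → Fin n,
        ∑ τ : Equiv.Perm (Fin 3), ((Equiv.Perm.sign τ : ℤ) : ℝ) *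
          ((∑ r, C a r (q (τ 0)) (q (τ 1)) * ℓ r) * lo ℓ (q (τ 2))) = 0))) ∧
    ((∀ b m : Fin n, ∑ a, ∑ l, SE C a b l m * ℓ a * ℓ l = 0) → mSq ℓ = 0) := by
  obtain ⟨h12, h34, hp, -, -⟩ := id hC
  have hcon := contrFst_swap ℓ h34
  have hwed := wedgeFst_swap ℓ h34
  let z : Fin n := ⟨0, by omega⟩
  have hz : (z : ℕ) = 0 := rfl
  have key : (∀ b m : Fin n, ∑ a, ∑ l, SE C a b l m * ℓ a * ℓ l = 0) →
      mSq ℓ = 0 ∧ (∀ r a b c, wedge ℓ (contrFst ℓ C r) a b c = 0) ∧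
      ∀ a b c d e f, wedge ℓ (wedgeFst ℓ C a b c) d e f = 0 := by
    intro hM
    have hzero := hM z z
    rw [sum_SE_eq_energy] at hzero
    have hsum := energy_energy_time ℓ hz h12
    rw [show energy ℓ z (fun s t s' t' =>
        energy ℓ z (tmul (fun a c => C a c s t) (fun a c => C a c s' t'))) = 0 by linarith,
      mul_zero] at hsum
    let q : (Fin n → Fin n → ℝ) → ℝ := fun F => 4 * ℓ z * energy ℓ z (tmul F F)
    have hq : (∑ r, q (contrFst ℓ C r)) + (∑ a, ∑ b, ∑ c, (1/6) * q (wedgeFst ℓ C a b c))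
        + ∑ a, ∑ b, (- mSq ℓ / 2) * q (C a b) = 0 := by
      rw [← mul_zero (4 * ℓ z), hsum]
      simp only [q, mul_add, mul_sum]
      congr 2 <;> simp only [mul_left_comm]
    have h1 : ∀ r ∈ univ, 0 ≤ q (contrFst ℓ C r) :=
      fun r _ => (energy_time_self hz (hcon r) hcausal).1
    have h2 : ∀ x ∈ (univ : Finset (Fin n × Fin n × Fin n)),
        0 ≤ (1/6) * q (wedgeFst ℓ C x.1 x.2.1 x.2.2) := fun x _ =>
      mul_nonneg (by norm_num) (energy_time_self hz (hwed x.1 x.2.1 x.2.2) hcausal).1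
    have h3 : ∀ x ∈ (univ : Finset (Fin n × Fin n)), 0 ≤ (- mSq ℓ / 2) * q (C x.1 x.2) :=
      fun x _ => mul_nonneg (by linarith) (energy_time_self hz (h34 x.1 x.2) hcausal).1
    have e1 := sum_nonneg h1
    have e2 := sum_nonneg h2
    have e3 := sum_nonneg h3
    have z2 := sum_eq_zero_iff_of_nonneg h2
    have z3 := sum_eq_zero_iff_of_nonneg h3
    simp only [Fintype.sum_prod_type] at e2 e3 z2 z3
    refine ⟨?_, fun r => ?_, fun a b c => ?_⟩
    · by_contra hne
      apply hC0
      funext a b c d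
      have := z3.1 (by linarith) (a, b) (mem_univ _)
      have hq0 : q (C a b) = 0 := by
        rcases mul_eq_zero.1 this with h | h
        · exact absurd (by linarith) hne
        · exact h
      exact (mul_eq_zero.1 (((energy_time_self hz (h34 a b) hcausal).2 hq0).2.2 c d)).resolve_left
        hne
    · exact ((energy_time_self hz (hcon r) hcausal).2
        ((sum_eq_zero_iff_of_nonneg h1).1 (by linarith) r (mem_univ _))).2.1
    · have := z2.1 (by linarith) (a, b, c) (mem_univ _)
      exact ((energy_time_self hz (hwed a b c) hcausal).2
        (show q (wedgeFst ℓ C a b c) = 0 by linarith)).2.1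
  have hperm : ∀ p q : Fin 3 → Fin n,
      ∑ σ : Equiv.Perm (Fin 3), ∑ τ : Equiv.Perm (Fin 3),
        ((Equiv.Perm.sign σ : ℤ) : ℝ) * ((Equiv.Perm.sign τ : ℤ) : ℝ) *
          (lo ℓ (p (σ 0)) * C (p (σ 1)) (p (σ 2)) (q (τ 0)) (q (τ 1)) * lo ℓ (q (τ 2)))
      = 4 * wedge ℓ (wedgeFst ℓ C (p 0) (p 1) (p 2)) (q 0) (q 1) (q 2) := by
    intro p q
    have h := sum_perm_mul_lo ℓ _ (hwed (p 0) (p 1) (p 2)) q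
    rw [show (4 : ℝ) * wedge ℓ (wedgeFst ℓ C (p 0) (p 1) (p 2)) (q 0) (q 1) (q 2)
      = 2 * (2 * wedge ℓ (wedgeFst ℓ C (p 0) (p 1) (p 2)) (q 0) (q 1) (q 2)) by ring, ← h,
      mul_sum, sum_comm]
    refine sum_congr rfl fun τ _ => ?_
    have h' := sum_perm_lo_mul ℓ (fun x y => C x y (q (τ 0)) (q (τ 1)))
      (fun _ _ => h12 _ _ _ _) p
    rw [wedgeFst, mul_left_comm, ← mul_assoc 2, ← h', sum_mul, mul_sum]
    exact sum_congr rfl fun σ _ => by ring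
  have hperm' : ∀ (a : Fin n) (q : Fin 3 → Fin n),
      ∑ τ : Equiv.Perm (Fin 3), ((Equiv.Perm.sign τ : ℤ) : ℝ) *
          ((∑ r, C a r (q (τ 0)) (q (τ 1)) * ℓ r) * lo ℓ (q (τ 2)))
      = - (2 * wedge ℓ (contrFst ℓ C a) (q 0) (q 1) (q 2)) := by
    intro a q
    rw [← sum_perm_mul_lo ℓ _ (hcon a) q, ← sum_neg_distrib]
    refine sum_congr rfl fun τ _ => ?_
    have : ∑ r, C a r (q (τ 0)) (q (τ 1)) * ℓ r = - contrFst ℓ C a (q (τ 0)) (q (τ 1)) := by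
      simp only [contrFst, contr, ← sum_neg_distrib]
      exact sum_congr rfl fun r _ => by rw [h12 r a]; ring
    rw [this]; ring
  refine ⟨⟨fun hM => ⟨fun p q => ?_, fun a q => ?_⟩, fun ⟨ha, hb⟩ b m => ?_⟩,
    fun hM => (key hM).1⟩
  · rw [hperm, (key hM).2.2, mul_zero]
  · rw [hperm', (key hM).2.1, mul_zero, neg_zero]
  · have hww : ∀ a b c d e f, wedge ℓ (wedgeFst ℓ C a b c) d e f = 0 := by
      intro a b c d e f
      have := ha ![a, b, c] ![d, e, f]
      rw [hperm] at this
      simpa using this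
    have hcw : ∀ r a b c, wedge ℓ (contrFst ℓ C r) a b c = 0 := by
      intro r a b c
      have := hb r ![a, b, c]
      rw [hperm'] at this
      simpa using this
    rw [sum_SE_eq_energy, energy_energy_eq ℓ b m h12]
    have h1 : ∀ r, energy ℓ m (tmul (contrFst ℓ C r) (C b r)) = 0 := fun r =>
      energy_tmul_eq_zero ℓ m (hcon r) (h34 b r) (contr_contrFst_eq_zero ℓ hC hww r) (hcw r)
    have h2 : ∀ r t, energy ℓ m (tmul (wedgeFst ℓ C b r t) (C r t)) = 0 := fun r t =>
      energy_tmul_eq_zero ℓ m (hwed b r t) (h34 r t)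
        (fun s => by rw [contr_wedgeFst ℓ hp, hcw]) (hww b r t)
    simp [h1, h2]
end
end

section
/- Let C be a nonzero Weyl candidate on n-dimensional Minkowski vector space with superenergy tensor 𝒯. If v is a causal vector satisfying 𝒯_{αβλμ} v^α v^β v^λ v^μ = 0, then v is null, i.e. η(v,v) = 0. -/
open Finset

noncomputable section

/-- The reflected inverse metric `η - c v ⊗ v`, positive definite for `v` timelike and
`c = 2 / η(v,v)`. -/
def reflectedMetric {n : ℕ} (c : ℝ) (v : Fin n → ℝ) : Matrix (Fin n) (Fin n) ℝ :=
  fun i j => eta i j - c * v i * v j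

lemma sum_sum_eta_mul {n : ℕ} (F : Fin n → Fin n → ℝ) :
    ∑ a, ∑ b, eta a b * F a b = ∑ a, sgn a * F a a := by
  simp [eta, ite_mul]

lemma sum_sum_reflectedMetric_mul {n : ℕ} (c : ℝ) (v : Fin n → ℝ) (F : Fin n → Fin n → ℝ) :
    ∑ a, ∑ b, reflectedMetric c v a b * F a b
      = ∑ a, sgn a * F a a - c * ∑ a, ∑ b, v a * v b * F a b := by
  simp only [reflectedMetric, sub_mul, sum_sub_distrib, sum_sum_eta_mul, mul_sum]
  congr 1
  exact sum_congr rfl fun a _ => sum_congr rfl fun b _ => by ring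

lemma sum_sum_antisymm {n : ℕ} (v : Fin n → ℝ) (X : Fin n → Fin n → ℝ)
    (hX : ∀ a b, X b a = -X a b) : ∑ a, v a * ∑ b, v b * X a b = 0 := by
  have h : ∑ a, v a * ∑ b, v b * X a b = -∑ a, v a * ∑ b, v b * X a b := by
    conv_lhs => simp only [mul_sum]; rw [sum_comm]
    simp only [mul_sum, ← sum_neg_distrib]
    exact sum_congr rfl fun a _ => sum_congr rfl fun b _ => by rw [hX a b]; ring
  linarith

lemma sum_sum_comm {ι : Type*} [Fintype ι] (F : ι → ι → ι → ι → ℝ) :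
    ∑ a, ∑ b, ∑ a', ∑ b', F a b a' b' = ∑ a, ∑ a', ∑ b, ∑ b', F a b a' b' :=
  sum_congr rfl fun _ _ => sum_comm

lemma sum_reflectedMetric_pair {n : ℕ} (c : ℝ) (v : Fin n → ℝ) (X Y : Fin n → Fin n → ℝ)
    (hX : ∀ a b, X b a = -X a b) (hY : ∀ a b, Y b a = -Y a b) :
    ∑ a, ∑ b, ∑ a', ∑ b', reflectedMetric c v a a' * reflectedMetric c v b b' *
        (X a b * Y a' b')
      = ∑ a, ∑ b, sgn a * sgn b * (X a b * Y a b)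
        - 2 * c * ∑ b, sgn b * ((∑ a, v a * X a b) * ∑ a, v a * Y a b) := by
  have inner (a a' : Fin n) :
      ∑ b, ∑ b', reflectedMetric c v b b' * (X a b * Y a' b')
        = ∑ b, sgn b * (X a b * Y a' b)
          - c * ((∑ b, v b * X a b) * ∑ b, v b * Y a' b) := by
    rw [sum_sum_reflectedMetric_mul, sum_mul_sum]
    congr 2
    exact sum_congr rfl fun a _ => sum_congr rfl fun b _ => by ring
  have flip (Z : Fin n → Fin n → ℝ) (hZ : ∀ a b, Z b a = -Z a b) (b : Fin n) :
      ∑ a, v a * Z b a = -∑ a, v a * Z a b := by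
    rw [← sum_neg_distrib]
    exact sum_congr rfl fun a _ => by rw [hZ a b]; ring
  have e1 : ∑ a, ∑ a', v a * v a' * ∑ b, sgn b * (X a b * Y a' b)
      = ∑ b, sgn b * ((∑ a, v a * X a b) * ∑ a, v a * Y a b) := by
    simp only [sum_mul_sum]
    simp only [mul_sum]
    rw [sum_comm]
    conv_lhs => enter [2, y]; rw [sum_comm]
    rw [sum_comm]
    refine sum_congr rfl fun b _ => ?_
    rw [sum_comm]
    exact sum_congr rfl fun a _ => sum_congr rfl fun b _ => by ring
  have e2 : ∑ a, ∑ a', v a * v a' * ((∑ b, v b * X a b) * ∑ b, v b * Y a' b) = 0 := by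
    have := sum_sum_antisymm v X hX
    calc _ = (∑ a, v a * ∑ b, v b * X a b) * ∑ a', v a' * ∑ b, v b * Y a' b := by
          rw [sum_mul_sum]
          exact sum_congr rfl fun a _ => sum_congr rfl fun b _ => by ring
      _ = 0 := by rw [this, zero_mul]
  rw [sum_sum_comm]
  simp only [mul_assoc (reflectedMetric c v _ _), ← mul_sum]
  rw [sum_sum_reflectedMetric_mul]
  simp only [inner]
  simp only [mul_sub, sum_sub_distrib]
  rw [e1]
  have e3 : ∑ a, ∑ a', v a * v a' * (c * ((∑ b, v b * X a b) * ∑ b, v b * Y a' b)) = 0 := by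
    rw [← mul_zero c, ← e2, mul_sum]
    refine sum_congr rfl fun a _ => ?_
    rw [mul_sum]
    exact sum_congr rfl fun b _ => by ring
  rw [e3]
  simp only [flip X hX, flip Y hY]
  have e4 : ∑ a, sgn a * (c * (-(∑ b, v b * X b a) * -∑ b, v b * Y b a))
      = c * ∑ b, sgn b * ((∑ a, v a * X a b) * ∑ a, v a * Y a b) := by
    rw [mul_sum]
    exact sum_congr rfl fun b _ => by ring
  rw [e4]
  simp only [mul_sum, mul_assoc]
  simp only [← mul_sum]
  ring

lemma reflectedMetric_posDef {n : ℕ} (v : Fin n → ℝ) (hv : mSq v < 0) :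
    (reflectedMetric (2 / mSq v) v).PosDef := by
  obtain _ | k := n
  · simp [mSq] at hv
  refine .of_dotProduct_mulVec_pos ?_ fun w hw => ?_
  · ext i j
    simp only [Matrix.conjTranspose_apply, reflectedMetric, star_trivial, eta]
    rcases eq_or_ne i j with rfl | h
    · rfl
    · simp [h, h.symm]; ring
  have hq : star w ⬝ᵥ (reflectedMetric (2 / mSq v) v).mulVec w
      = mSq w - 2 / mSq v * (∑ a, v a * w a) ^ 2 := by
    generalize 2 / mSq v = c
    have := sum_sum_reflectedMetric_mul c v (fun a b => w a * w b)
    rw [sq, sum_mul_sum, mSq]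
    convert this using 1
    · simp only [dotProduct, Matrix.mulVec, mul_sum, star_trivial]
      exact sum_congr rfl fun a _ => sum_congr rfl fun b _ => by ring
    · congr 1
      · exact sum_congr rfl fun a _ => by ring
      · congr 1
        exact sum_congr rfl fun a _ => sum_congr rfl fun b _ => by ring
  rw [hq]
  set V := ∑ i : Fin k, v i.succ ^ 2 with hV
  set W := ∑ i : Fin k, w i.succ ^ 2 with hW
  set x := ∑ i : Fin k, v i.succ * w i.succ with hx
  have split (u : Fin (k + 1) → ℝ) : mSq u = -u 0 ^ 2 + ∑ i : Fin k, u i.succ ^ 2 := by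
    rw [mSq, Fin.sum_univ_succ]
    simp [sgn, sq]
  have cs : x ^ 2 ≤ V * W := sum_mul_sq_le_sq_mul_sq _ _ _
  have hV0 : 0 ≤ V := sum_nonneg fun i _ => sq_nonneg _
  have hW0 : 0 ≤ W := sum_nonneg fun i _ => sq_nonneg _
  rw [split w, Fin.sum_univ_succ, ← hx, ← hW]
  rw [split v, ← hV] at hv ⊢
  obtain ⟨D, hD⟩ : ∃ D, D = v 0 ^ 2 - V := ⟨_, rfl⟩
  have hDpos : 0 < D := by linarith
  have hA : 0 < v 0 ^ 2 + V := by linarith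
  have key : (v 0 ^ 2 + V) * (D * (-w 0 ^ 2 + W) + 2 * (v 0 * w 0 + x) ^ 2)
      = ((v 0 ^ 2 + V) * w 0 + 2 * v 0 * x) ^ 2 + D * (D * W + 2 * (V * W - x ^ 2)) := by
    rw [hD]; ring
  have pos : 0 < D * (-w 0 ^ 2 + W) + 2 * (v 0 * w 0 + x) ^ 2 := by
    refine pos_of_mul_pos_right ?_ hA.le
    rw [key]
    rcases hW0.eq_or_lt with h0 | h0
    · have hx0 : x = 0 := by
        rw [← h0, mul_zero] at cs
        exact pow_eq_zero_iff two_ne_zero |>.1 (le_antisymm cs (sq_nonneg _))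
      have hw0 : w 0 ≠ 0 := by
        intro h
        apply hw
        funext i
        refine Fin.cases h (fun j => ?_) i
        have := (sum_eq_zero_iff_of_nonneg fun i _ => sq_nonneg (w (Fin.succ i))).1 h0.symm j
          (mem_univ _)
        simpa using this
      rw [hx0, ← h0]
      simp only [mul_zero, add_zero, ne_eq, OfNat.ofNat_ne_zero, not_false_eq_true, zero_pow,
        sub_zero]
      positivity
    · have : 0 ≤ V * W - x ^ 2 := by linarith
      positivity
  have e : -v 0 ^ 2 + V = -D := by rw [hD]; ring
  rw [e]
  have : -w 0 ^ 2 + W - 2 / -D * (v 0 * w 0 + x) ^ 2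
      = (D * (-w 0 ^ 2 + W) + 2 * (v 0 * w 0 + x) ^ 2) / D := by
    field_simp
    ring
  rw [this]
  positivity


lemma sum_four_two_comm {ι : Type*} [Fintype ι] (F : ι → ι → ι → ι → ι → ι → ℝ) :
    ∑ a, ∑ b, ∑ l, ∑ m, ∑ r, ∑ s, F a b l m r s
      = ∑ r, ∑ s, ∑ a, ∑ b, ∑ l, ∑ m, F a b l m r s := by
  have := sum_comm (s := univ) (t := univ)
    (f := fun (x : ι × ι × ι × ι) (y : ι × ι) => F x.1 x.2.1 x.2.2.1 x.2.2.2 y.1 y.2)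
  simpa only [Fintype.sum_prod_type] using this

lemma sum_four_one_comm {ι : Type*} [Fintype ι] (F : ι → ι → ι → ι → ι → ℝ) :
    ∑ a, ∑ b, ∑ l, ∑ m, ∑ r, F a b l m r = ∑ r, ∑ a, ∑ b, ∑ l, ∑ m, F a b l m r := by
  have := sum_comm (s := univ) (t := univ)
    (f := fun (x : ι × ι × ι × ι) (y : ι) => F x.1 x.2.1 x.2.2.1 x.2.2.2 y)
  simpa only [Fintype.sum_prod_type] using this

lemma sum_two_three_comm {ι : Type*} [Fintype ι] (F : ι → ι → ι → ι → ι → ℝ) :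
    ∑ a, ∑ b, ∑ r, ∑ s, ∑ t, F a b r s t = ∑ r, ∑ s, ∑ t, ∑ a, ∑ b, F a b r s t := by
  have := sum_comm (s := univ) (t := univ)
    (f := fun (x : ι × ι) (y : ι × ι × ι) => F x.1 x.2 y.1 y.2.1 y.2.2)
  simpa only [Fintype.sum_prod_type] using this

/-- The square norm of `C` for the bilinear form `p` on each slot. -/
def slotNorm {n : ℕ} (p : Matrix (Fin n) (Fin n) ℝ)
    (C : Fin n → Fin n → Fin n → Fin n → ℝ) : ℝ :=
  ∑ a, ∑ b, ∑ a', ∑ b', p a a' * p b b' *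
    ∑ l, ∑ m, ∑ l', ∑ m', p l l' * p m m' * (C a b l m * C a' b' l' m')

lemma slotNorm_pos {n : ℕ} {p : Matrix (Fin n) (Fin n) ℝ} (hp : p.PosDef)
    {C : Fin n → Fin n → Fin n → Fin n → ℝ} (hC : C ≠ 0) : 0 < slotNorm p C := by
  let x : (Fin n × Fin n) × (Fin n × Fin n) → ℝ := fun y => C y.1.1 y.1.2 y.2.1 y.2.2
  have hx : x ≠ 0 := by
    intro h
    apply hC
    funext a b l m
    exact congrFun h ((a, b), (l, m))
  refine (((hp.kronecker hp).kronecker (hp.kronecker hp)).dotProduct_mulVec_pos hx).trans_eq ?_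
  symm
  simp only [slotNorm, dotProduct, Matrix.mulVec, Fintype.sum_prod_type, mul_sum,
    Matrix.kroneckerMap_apply, star_trivial, x]
  refine sum_congr rfl fun a _ => sum_congr rfl fun b _ => ?_
  have := sum_comm (s := univ) (t := univ)
    (f := fun (y : Fin n × Fin n) (z : Fin n × Fin n) => ∑ l', ∑ m',
      p a y.1 * p b y.2 * (p z.1 l' * p z.2 m' * (C a b z.1 z.2 * C y.1 y.2 l' m')))
  simp only [Fintype.sum_prod_type] at this
  rw [this]
  exact sum_congr rfl fun _ _ => sum_congr rfl fun _ _ => sum_congr rfl fun _ _ =>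
    sum_congr rfl fun _ _ => sum_congr rfl fun _ _ => sum_congr rfl fun _ _ => by ring

lemma slotNorm_reflectedMetric {n : ℕ} (c : ℝ) (v : Fin n → ℝ)
    (C : Fin n → Fin n → Fin n → Fin n → ℝ) (h₁ : ∀ a b l m, C b a l m = -C a b l m)
    (h₂ : ∀ a b l m, C a b m l = -C a b l m) :
    slotNorm (reflectedMetric c v) C
      = ∑ l, ∑ m, sgn l * sgn m * (∑ a, ∑ b, sgn a * sgn b * (C a b l m * C a b l m))
        - 2 * c * ∑ l, ∑ m, sgn l * sgn m *
          ∑ b, sgn b * ((∑ a, v a * C a b l m) * ∑ a, v a * C a b l m)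
        - 2 * c * (∑ m, sgn m * ∑ a, ∑ b, sgn a * sgn b *
            ((∑ l, v l * C a b l m) * ∑ l, v l * C a b l m)
          - 2 * c * ∑ m, sgn m * ∑ b, sgn b *
            ((∑ a, v a * ∑ l, v l * C a b l m) * ∑ a, v a * ∑ l, v l * C a b l m)) := by
  set p := reflectedMetric c v
  have inner (a b a' b' : Fin n) :
      ∑ l, ∑ m, ∑ l', ∑ m', p l l' * p m m' * (C a b l m * C a' b' l' m') = _ :=
    sum_reflectedMetric_pair c v (C a b) (C a' b') (h₂ a b) (h₂ a' b')
  have outer (l m : Fin n) :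
      ∑ a, ∑ b, ∑ a', ∑ b', p a a' * p b b' * (C a b l m * C a' b' l m) = _ :=
    sum_reflectedMetric_pair c v (fun a b => C a b l m) (fun a b => C a b l m)
      (fun a b => h₁ a b l m) (fun a b => h₁ a b l m)
  have anti (m a b : Fin n) : ∑ l, v l * C b a l m = -∑ l, v l * C a b l m := by
    rw [← sum_neg_distrib]
    exact sum_congr rfl fun l _ => by rw [h₁ a b]; ring
  have outer' (m : Fin n) :
      ∑ a, ∑ b, ∑ a', ∑ b', p a a' * p b b' *
        ((∑ l, v l * C a b l m) * ∑ l, v l * C a' b' l m) = _ :=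
    sum_reflectedMetric_pair c v (fun a b => ∑ l, v l * C a b l m)
      (fun a b => ∑ l, v l * C a b l m) (anti m) (anti m)
  have s₁ : ∑ a, ∑ b, ∑ a', ∑ b', p a a' * p b b' *
        ∑ l, ∑ m, sgn l * sgn m * (C a b l m * C a' b' l m)
      = ∑ l, ∑ m, sgn l * sgn m *
        ∑ a, ∑ b, ∑ a', ∑ b', p a a' * p b b' * (C a b l m * C a' b' l m) := by
    simp only [mul_sum]
    rw [sum_four_two_comm]
    simp only [mul_left_comm]
  have s₂ : ∑ a, ∑ b, ∑ a', ∑ b', p a a' * p b b' *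
        (2 * c * ∑ m, sgn m * ((∑ l, v l * C a b l m) * ∑ l, v l * C a' b' l m))
      = 2 * c * ∑ m, sgn m * ∑ a, ∑ b, ∑ a', ∑ b', p a a' * p b b' *
        ((∑ l, v l * C a b l m) * ∑ l, v l * C a' b' l m) := by
    generalize hG : (fun a b m => ∑ l, v l * C a b l m) = G
    have hG' (a b m : Fin n) : ∑ l, v l * C a b l m = G a b m := by rw [← hG]
    simp only [hG', mul_sum]
    rw [sum_four_one_comm]
    exact sum_congr rfl fun _ _ => sum_congr rfl fun _ _ => sum_congr rfl fun _ _ =>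
      sum_congr rfl fun _ _ => sum_congr rfl fun _ _ => by ring
  rw [slotNorm]
  simp only [inner, mul_sub, sum_sub_distrib]
  rw [s₁, s₂]
  simp only [outer, outer', mul_sub, sum_sub_distrib]
  simp only [mul_left_comm _ (2 * c), ← mul_sum]

lemma superenergy_contraction {n : ℕ} (v : Fin n → ℝ)
    (C : Fin n → Fin n → Fin n → Fin n → ℝ) :
    ∑ a, ∑ b, ∑ l, ∑ m, SE C a b l m * v a * v b * v l * v m
      = 2 * (∑ m, sgn m * ∑ b, sgn b *
            ((∑ a, v a * ∑ l, v l * C a b l m) * ∑ a, v a * ∑ l, v l * C a b l m))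
        - (1 / 2) * mSq v * (∑ m, sgn m * ∑ a, ∑ b, sgn a * sgn b *
            ((∑ l, v l * C a b l m) * ∑ l, v l * C a b l m))
        - (1 / 2) * mSq v * (∑ l, ∑ m, sgn l * sgn m *
          ∑ b, sgn b * ((∑ a, v a * C a b l m) * ∑ a, v a * C a b l m))
        + (1 / 8) * mSq v ^ 2 *
          ∑ l, ∑ m, sgn l * sgn m * (∑ a, ∑ b, sgn a * sgn b * (C a b l m * C a b l m)) := by
  have hq : ∑ a, ∑ b, eta a b * (v a * v b) = mSq v := by
    rw [sum_sum_eta_mul, mSq]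
    exact sum_congr rfl fun a _ => by ring
  have factor (k : ℝ) (F G : Fin n → Fin n → ℝ) :
      ∑ a, ∑ b, ∑ l, ∑ m, k * (F a b * G l m)
        = k * ((∑ a, ∑ b, F a b) * ∑ l, ∑ m, G l m) := by
    simp only [← mul_sum, ← sum_mul]
  have t₁ : ∑ a, ∑ b, ∑ l, ∑ m, v a * v b * v l * v m *
        (∑ r, ∑ s, sgn r * sgn s * (C a r l s * C b r m s))
      = ∑ m, sgn m * ∑ b, sgn b *
            ((∑ a, v a * ∑ l, v l * C a b l m) * ∑ a, v a * ∑ l, v l * C a b l m) := by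
    have square (b m : Fin n) :
        (∑ a, v a * ∑ l, v l * C a b l m) * ∑ a, v a * ∑ l, v l * C a b l m
          = ∑ a, ∑ a', ∑ l, ∑ l', v a * v a' * v l * v l' * (C a b l m * C a' b l' m) := by
      rw [sum_mul_sum]
      refine sum_congr rfl fun _ _ => sum_congr rfl fun _ _ => ?_
      rw [mul_mul_mul_comm, sum_mul_sum]
      simp only [mul_sum]
      exact sum_congr rfl fun _ _ => sum_congr rfl fun _ _ => by ring
    simp only [square]
    simp only [mul_sum]
    rw [sum_four_two_comm, sum_comm]
    refine sum_congr rfl fun s _ => sum_congr rfl fun r _ => sum_congr rfl fun a _ =>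
      sum_congr rfl fun b _ => ?_
    exact sum_congr rfl fun l _ => sum_congr rfl fun m _ => by ring
  have t₂ : ∑ a, ∑ b, ∑ l, ∑ m, v a * v b * v l * v m *
        (∑ r, ∑ s, sgn r * sgn s * (C a r m s * C b r l s))
      = ∑ a, ∑ b, ∑ l, ∑ m, v a * v b * v l * v m *
        (∑ r, ∑ s, sgn r * sgn s * (C a r l s * C b r m s)) := by
    refine sum_congr rfl fun a _ => sum_congr rfl fun b _ => ?_
    rw [sum_comm]
    exact sum_congr rfl fun l _ => sum_congr rfl fun m _ => by ring
  have t₃ : ∑ l, ∑ m, v l * v m *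
        (∑ r, ∑ t, ∑ s, sgn r * sgn t * sgn s * C r t l s * C r t m s)
      = ∑ m, sgn m * ∑ a, ∑ b, sgn a * sgn b *
            ((∑ l, v l * C a b l m) * ∑ l, v l * C a b l m) := by
    simp only [sum_mul_sum]
    simp only [mul_sum]
    rw [sum_two_three_comm]
    conv_rhs => rw [sum_comm]
    refine sum_congr rfl fun r _ => ?_
    conv_rhs => rw [sum_comm]
    exact sum_congr rfl fun _ _ => sum_congr rfl fun _ _ => sum_congr rfl fun _ _ =>
      sum_congr rfl fun _ _ => by ring
  have t₄ : ∑ a, ∑ b, v a * v b *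
        (∑ r, ∑ s, ∑ t, sgn r * sgn s * sgn t * C a r s t * C b r s t)
      = ∑ l, ∑ m, sgn l * sgn m *
          ∑ b, sgn b * ((∑ a, v a * C a b l m) * ∑ a, v a * C a b l m) := by
    simp only [sum_mul_sum]
    simp only [mul_sum]
    rw [sum_two_three_comm, sum_comm]
    refine sum_congr rfl fun l _ => ?_
    rw [sum_comm]
    exact sum_congr rfl fun _ _ => sum_congr rfl fun _ _ => sum_congr rfl fun _ _ =>
      sum_congr rfl fun _ _ => by ring
  have t₅ : ∑ r, ∑ t, ∑ s, ∑ u : Fin n, sgn r * sgn t * sgn s * sgn u * C r t s u * C r t s u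
      = ∑ l, ∑ m, sgn l * sgn m * (∑ a, ∑ b, sgn a * sgn b * (C a b l m * C a b l m)) := by
    have := sum_comm (s := univ) (t := univ)
      (f := fun (x : Fin n × Fin n) (y : Fin n × Fin n) =>
        sgn x.1 * sgn x.2 * sgn y.1 * sgn y.2 * C x.1 x.2 y.1 y.2 * C x.1 x.2 y.1 y.2)
    simp only [Fintype.sum_prod_type] at this
    rw [this]
    simp only [mul_sum]
    exact sum_congr rfl fun _ _ => sum_congr rfl fun _ _ => sum_congr rfl fun _ _ =>
      sum_congr rfl fun _ _ => by ring
  have expand (a b l m : Fin n) : SE C a b l m * v a * v b * v l * v m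
      = v a * v b * v l * v m * (∑ r, ∑ s, sgn r * sgn s * (C a r l s * C b r m s))
        + v a * v b * v l * v m * (∑ r, ∑ s, sgn r * sgn s * (C a r m s * C b r l s))
        - (1 / 2) * ((eta a b * (v a * v b)) * (v l * v m *
          (∑ r, ∑ t, ∑ s, sgn r * sgn t * sgn s * C r t l s * C r t m s)))
        - (1 / 2) * ((v a * v b *
          (∑ r, ∑ s, ∑ t, sgn r * sgn s * sgn t * C a r s t * C b r s t))
            * (eta l m * (v l * v m)))
        + (1 / 8) * (∑ r, ∑ t, ∑ s, ∑ v, sgn r * sgn t * sgn s * sgn v * C r t s v * C r t s v)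
          * ((eta a b * (v a * v b)) * (eta l m * (v l * v m))) := by
    simp only [SE, mul_add, sum_add_distrib]
    ring
  simp only [expand, sum_add_distrib, sum_sub_distrib]
  rw [factor, factor, factor, t₂, t₁, t₃, t₄, t₅, hq]
  ring

/-- any causal vector annihilating the superenergy tensor of a
nonzero Weyl candidate upon full contraction must be null. -/
theorem stmt_9 {n : ℕ} (hn : 2 ≤ n) (C : Fin n → Fin n → Fin n → Fin n → ℝ)
    (hC : IsWeyl C) (hC0 : C ≠ 0)
    (v : Fin n → ℝ) (hv0 : v ≠ 0) (hcausal : mSq v ≤ 0)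
    (h : ∑ a, ∑ b, ∑ l, ∑ m, SE C a b l m * v a * v b * v l * v m = 0) :
    mSq v = 0 := by
  by_contra hne
  have hq : mSq v < 0 := lt_of_le_of_ne hcausal hne
  have hpos := slotNorm_pos (reflectedMetric_posDef v hq) hC0
  rw [slotNorm_reflectedMetric _ v C hC.1 hC.2.1] at hpos
  rw [superenergy_contraction] at h
  have cancel (q c A B D E : ℝ) (hc : c * q = 2)
      (h : 2 * E - (1 / 2) * q * D - (1 / 2) * q * B + (1 / 8) * q ^ 2 * A = 0) :
      q ^ 2 * (A - 2 * c * B - 2 * c * (D - 2 * c * E)) = 0 := by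
    linear_combination 8 * h + (-2 * q * B - 2 * q * D + 4 * (c * q + 2) * E) * hc
  exact (mul_pos (sq_pos_of_neg hq) hpos).ne' (cancel _ _ _ _ _ _ (div_mul_cancel₀ 2 hne) h)
end
end

section
/- In n-dimensional Minkowski vector space, let ℓ be a null vector and let S_{αβ} be a symmetric 2-index real array satisfying S_{αβ}ℓ^β = 0 for all α. Then S_{αβ}S^{αβ} = 0 (where S^{αβ} := η^{αρ}η^{βσ}S_{ρσ}) if and only if there exists a covector v_β with v_βℓ^β = 0 such that S_{αβ} = ℓ_α v_β + ℓ_β v_α for all α,β, where ℓ_α := η_{αβ}ℓ^β. -/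
open Finset

noncomputable section

theorem sgn_of_ne {n : ℕ} {i : Fin n} (h : (i : ℕ) ≠ 0) : sgn i = 1 := if_neg h

/-- A nonzero null vector has a nonzero time component. -/
theorem time_component_ne_zero {n : ℕ} {ℓ : Fin n → ℝ} (hℓ0 : ℓ ≠ 0) (hnull : mSq ℓ = 0)
    {o : Fin n} (ho : (o : ℕ) = 0) : ℓ o ≠ 0 := by
  intro h
  have key : ∀ i, 0 ≤ sgn i * ℓ i * ℓ i := by
    intro i
    by_cases hi : (i : ℕ) = 0
    · obtain rfl : i = o := Fin.ext (hi.trans ho.symm)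
      simp [h]
    · rw [sgn_of_ne hi, one_mul]
      exact mul_self_nonneg _
  have hz := (Finset.sum_eq_zero_iff_of_nonneg fun i _ => key i).1 hnull
  refine hℓ0 (funext fun i => ?_)
  by_cases hi : (i : ℕ) = 0
  · obtain rfl : i = o := Fin.ext (hi.trans ho.symm)
    exact h
  · simpa [sgn_of_ne hi] using hz i (mem_univ i)

/-- The Lorentzian square of a symmetric array annihilated by a null vector `ℓ` does not change
when `ℓ_a v_b + ℓ_b v_a` is added to the array, for `v` annihilated by `ℓ`. -/
theorem sum_sq_add_lo_mul {n : ℕ} {ℓ v : Fin n → ℝ} {Q : Fin n → Fin n → ℝ}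
    (hnull : mSq ℓ = 0) (hv : ∑ b, v b * ℓ b = 0) (hQsym : ∀ a b, Q a b = Q b a)
    (hQ : ∀ a, ∑ b, Q a b * ℓ b = 0) :
    ∑ a, ∑ b, sgn a * sgn b * (Q a b + (lo ℓ a * v b + lo ℓ b * v a)) *
        (Q a b + (lo ℓ a * v b + lo ℓ b * v a)) =
      ∑ a, ∑ b, sgn a * sgn b * Q a b * Q a b := by
  have hpt : ∀ a b, sgn a * sgn b * (Q a b + (lo ℓ a * v b + lo ℓ b * v a)) *
        (Q a b + (lo ℓ a * v b + lo ℓ b * v a)) =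
      sgn a * sgn b * Q a b * Q a b + 2 * (sgn b * v b) * (Q b a * ℓ a) +
        2 * (sgn a * v a) * (Q a b * ℓ b) + (sgn b * v b * v b) * (sgn a * ℓ a * ℓ a) +
        2 * (v a * ℓ a) * (v b * ℓ b) + (sgn a * v a * v a) * (sgn b * ℓ b * ℓ b) := by
    intro a b
    rw [hQsym b a]
    unfold lo
    have ha := sgn_mul_self a
    have hb := sgn_mul_self b
    grind
  have h1 : ∑ a, ∑ b, 2 * (sgn b * v b) * (Q b a * ℓ a) = 0 := by
    rw [Finset.sum_comm]
    simp [← Finset.mul_sum, hQ]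
  have h2 : ∑ a, ∑ b, (sgn b * v b * v b) * (sgn a * ℓ a * ℓ a) = 0 := by
    rw [Finset.sum_comm]
    unfold mSq at hnull
    simp [← Finset.mul_sum, hnull]
  unfold mSq at hnull
  simp only [hpt, Finset.sum_add_distrib, h1, h2]
  simp only [← Finset.mul_sum, hQ, hv, hnull]
  simp

/-- for a null ℓ and a symmetric S with S_{αβ}ℓ^β = 0, one has
S_{αβ}S^{αβ} = 0 iff S_{αβ} = ℓ_α v_β + ℓ_β v_α for some covector v with v_βℓ^β = 0. -/
theorem stmt_11 {n : ℕ} (hn : 2 ≤ n)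
    (ℓ : Fin n → ℝ) (hℓ0 : ℓ ≠ 0) (hnull : mSq ℓ = 0)
    (S : Fin n → Fin n → ℝ) (hSsym : ∀ a b, S a b = S b a)
    (hSl : ∀ a, ∑ b, S a b * ℓ b = 0) :
    (∑ a, ∑ b, sgn a * sgn b * S a b * S a b = 0) ↔
      ∃ v : Fin n → ℝ, (∑ b, v b * ℓ b = 0) ∧
        ∀ a b, S a b = lo ℓ a * v b + lo ℓ b * v a := by
  constructor
  · intro hS
    obtain ⟨o, ho⟩ : ∃ o : Fin n, (o : ℕ) = 0 := ⟨⟨0, by lia⟩, rfl⟩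
    have hk : lo ℓ o ≠ 0 := by
      simpa [lo, sgn, ho] using time_component_ne_zero hℓ0 hnull ho
    have hkℓ : ∑ b, lo ℓ b * ℓ b = 0 := hnull
    obtain ⟨v, hvdef⟩ : ∃ v : Fin n → ℝ, ∀ b,
        v b = (lo ℓ o)⁻¹ * (S o b - S o o / (2 * lo ℓ o) * lo ℓ b) := ⟨_, fun _ => rfl⟩
    have hv : ∑ b, v b * ℓ b = 0 := by
      simp only [hvdef, mul_assoc, sub_mul, ← Finset.mul_sum, Finset.sum_sub_distrib, hSl, hkℓ]
      simp
    obtain ⟨Q, hQdef⟩ : ∃ Q : Fin n → Fin n → ℝ, ∀ a b,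
        Q a b = S a b - (lo ℓ a * v b + lo ℓ b * v a) := ⟨_, fun _ _ => rfl⟩
    have hQsym : ∀ a b, Q a b = Q b a := by
      intro a b
      rw [hQdef, hQdef, hSsym a b]
      ring
    have hQ : ∀ a, ∑ b, Q a b * ℓ b = 0 := by
      intro a
      have : ∀ b, Q a b * ℓ b =
          S a b * ℓ b - (lo ℓ a * (v b * ℓ b) + v a * (lo ℓ b * ℓ b)) := by
        intro b
        rw [hQdef]
        ring
      simp only [this, Finset.sum_sub_distrib, Finset.sum_add_distrib, ← Finset.mul_sum, hSl, hv,
        hkℓ]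
      simp
    have hQo : ∀ b, Q o b = 0 := by
      intro b
      rw [hQdef, hvdef, hvdef]
      field_simp
      ring
    have hSQ : ∀ a b, S a b = Q a b + (lo ℓ a * v b + lo ℓ b * v a) := by
      intro a b
      rw [hQdef]
      ring
    have hQQ : ∑ a, ∑ b, sgn a * sgn b * Q a b * Q a b = 0 := by
      rw [← sum_sq_add_lo_mul hnull hv hQsym hQ]
      simpa only [hSQ] using hS
    have hterm : ∀ a b, sgn a * sgn b * Q a b * Q a b = Q a b * Q a b := by
      intro a b
      by_cases ha : (a : ℕ) = 0
      · obtain rfl : a = o := Fin.ext (ha.trans ho.symm)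
        simp [hQo]
      by_cases hb : (b : ℕ) = 0
      · obtain rfl : b = o := Fin.ext (hb.trans ho.symm)
        simp [hQsym a b, hQo]
      simp [sgn_of_ne ha, sgn_of_ne hb]
    simp only [hterm] at hQQ
    refine ⟨v, hv, fun a b => ?_⟩
    have h1 := (Finset.sum_eq_zero_iff_of_nonneg fun a _ =>
      Finset.sum_nonneg fun b _ => mul_self_nonneg (Q a b)).1 hQQ a (mem_univ a)
    have h2 := (Finset.sum_eq_zero_iff_of_nonneg fun b _ =>
      mul_self_nonneg (Q a b)).1 h1 b (mem_univ b)
    rw [hSQ, mul_self_eq_zero.1 h2, zero_add]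
  · rintro ⟨v, hv, hS⟩
    have h := sum_sq_add_lo_mul (Q := fun _ _ => 0) hnull hv (by simp) (by simp)
    simpa [hS] using h
end
end
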